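/- Let ε₁, ε₂, ε₃ ∈ {±1} be signs, not all equal, and let k ∈ ℤ_L^d, β ∈ ℝ. Then the number of triples (k₁,k₂,k₃) ∈ (ℤ_L^d)³ with |k_j − k_j⁰| ≤ 1 for j = 1,2,3, with ε₁k₁ + ε₂k₂ + ε₃k₃ = k, and with | ε₁|k₁|² + ε₂|k₂|² + ε₃|k₃|² − β | ≤ δ^{−1}L^{−2γ}, is at most C·δ^{−1}·L^{2(d−γ)}. -/

import Mathlib

open scoped RealInnerProductSpace BigOperators

noncomputable section

/-- The rescaled lattice `ℤ_L^d = (L⁻¹ℤ)^d` inside `ℝ^d`. -/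
def ZLat (d : ℕ) (L : ℝ) : Set (EuclideanSpace ℝ (Fin d)) :=
  {x | ∀ i, ∃ m : ℤ, x i = (m : ℝ) / L}

/-- A set of integers in an interval of length `N`, all congruent modulo `r`, has at most
`N / r + 1` elements. -/
theorem card_mul_le_of_dvd_sub (S : Finset ℤ) (p : ℤ) (N r : ℕ) (hr : 0 < r)
    (hS : ∀ a ∈ S, p ≤ a ∧ a ≤ p + N) (hmod : ∀ a ∈ S, ∀ b ∈ S, (r : ℤ) ∣ a - b) :
    S.card * r ≤ N + r := by
  have hr' : (0 : ℤ) < r := by exact_mod_cast hr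
  have h : S.card ≤ (Finset.Icc (0 : ℤ) (N / r)).card := by
    refine Finset.card_le_card_of_injOn (fun s => (s - p) / r) ?_ ?_
    · intro a ha
      obtain ⟨h1, h2⟩ := hS a ha
      simp only [Finset.coe_Icc, Set.mem_Icc]
      exact ⟨Int.ediv_nonneg (by omega) hr'.le, Int.ediv_le_ediv hr' (by omega)⟩
    · intro a ha b hb hab
      obtain ⟨t, ht⟩ := hmod a ha b hb
      have h1 : (a - p) = (b - p) + r * t := by linarith
      simp only at hab
      rw [h1, Int.add_mul_ediv_left _ _ hr'.ne'] at hab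
      have : t = 0 := by omega
      subst this
      linarith
  have h2 : (Finset.Icc (0 : ℤ) (N / r)).card = N / r + 1 := by
    rw [Int.card_Icc]
    rw [← Int.natCast_div]
    generalize N / r = x
    omega
  calc S.card * r ≤ (N / r + 1) * r := Nat.mul_le_mul_right _ (h.trans h2.le)
    _ = N / r * r + r := by ring
    _ ≤ N + r := by gcongr; exact Nat.div_mul_le_self N r

/-- Lattice points of a box in a strip around the line `a k + h b = 0`. -/
def stripPoints (p q : ℤ) (N M : ℕ) (h k : ℤ) : Finset (ℤ × ℤ) :=
  (Finset.Icc p (p + N) ×ˢ Finset.Icc q (q + N)).filter (fun x => |x.1 * k + h * x.2| ≤ M)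

theorem mem_stripPoints {p q : ℤ} {N M : ℕ} {h k : ℤ} {x : ℤ × ℤ} :
    x ∈ stripPoints p q N M h k ↔
      ((p ≤ x.1 ∧ x.1 ≤ p + N) ∧ (q ≤ x.2 ∧ x.2 ≤ q + N)) ∧ |x.1 * k + h * x.2| ≤ M := by
  simp [stripPoints]

theorem card_stripPoints_swap (p q : ℤ) (N M : ℕ) (h k : ℤ) :
    (stripPoints p q N M h k).card = (stripPoints q p N M k h).card := by
  refine Finset.card_bij (fun x _ => x.swap) ?_ ?_ ?_
  · intro x hx
    rw [mem_stripPoints] at hx ⊢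
    refine ⟨⟨hx.1.2, hx.1.1⟩, ?_⟩
    have : x.swap.1 * h + k * x.swap.2 = x.1 * k + h * x.2 := by simp; ring
    rw [this]; exact hx.2
  · intro x _ y _ hxy
    exact Prod.swap_injective hxy
  · intro x hx
    refine ⟨x.swap, ?_, by simp⟩
    rw [mem_stripPoints] at hx ⊢
    refine ⟨⟨hx.1.2, hx.1.1⟩, ?_⟩
    have : x.swap.1 * k + h * x.swap.2 = x.1 * h + k * x.2 := by simp; ring
    rw [this]; exact hx.2

theorem card_stripPoints_mul_le (p q : ℤ) (N M : ℕ) (h k : ℤ) (hh : h ≠ 0) (hN : h.natAbs ≤ N) :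
    (stripPoints p q N M h k).card * h.natAbs ≤ (2 * M + Int.gcd h k) * (2 * N) := by
  set g := Int.gcd h k with hg
  have hg0 : 0 < g := Int.gcd_pos_of_ne_zero_left _ hh
  obtain ⟨h', hh'⟩ : (g : ℤ) ∣ h := Int.gcd_dvd_left ..
  obtain ⟨k', hk'⟩ : (g : ℤ) ∣ k := Int.gcd_dvd_right ..
  have hg0' : (0 : ℤ) < g := by exact_mod_cast hg0
  have hcop : IsCoprime h' k' := by
    have h1 : (g : ℤ) = h * Int.gcdA h k + k * Int.gcdB h k := Int.gcd_eq_gcd_ab h k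
    refine ⟨Int.gcdA h k, Int.gcdB h k, ?_⟩
    have h2 : (g : ℤ) * (Int.gcdA h k * h' + Int.gcdB h k * k') = g * 1 := by
      calc (g : ℤ) * (Int.gcdA h k * h' + Int.gcdB h k * k')
          = (g * h') * Int.gcdA h k + (g * k') * Int.gcdB h k := by ring
        _ = g * 1 := by rw [← hh', ← hk', ← h1]; ring
    exact mul_left_cancel₀ hg0'.ne' h2
  have hh'0 : h' ≠ 0 := by rintro rfl; simp at hh'; exact hh hh'
  have hr : 0 < h'.natAbs := Int.natAbs_pos.mpr hh'0
  have hnat : h.natAbs = g * h'.natAbs := by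
    rw [hh', Int.natAbs_mul, Int.natAbs_natCast]
  set f : ℤ × ℤ → ℤ := fun x => x.1 * k' + h' * x.2 with hf
  have hfg : ∀ x : ℤ × ℤ, x.1 * k + h * x.2 = g * f x := by
    intro x; simp only [hf]; rw [hh', hk']; ring
  have hmaps : ∀ x ∈ stripPoints p q N M h k,
      f x ∈ Finset.Icc (-((M / g : ℕ) : ℤ)) ((M / g : ℕ) : ℤ) := by
    intro x hx
    rw [mem_stripPoints, hfg, abs_mul, abs_of_pos hg0'] at hx
    rw [Finset.mem_Icc, ← abs_le]
    push_cast
    rw [Int.le_ediv_iff_mul_le hg0', mul_comm]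
    exact hx.2
  have hfib : ∀ t ∈ Finset.Icc (-((M / g : ℕ) : ℤ)) ((M / g : ℕ) : ℤ),
      ((stripPoints p q N M h k).filter (fun x => f x = t)).card ≤ N / h'.natAbs + 1 := by
    intro t _
    set F := (stripPoints p q N M h k).filter (fun x => f x = t) with hF
    have hmem : ∀ x ∈ F, (p ≤ x.1 ∧ x.1 ≤ p + N) ∧ x.1 * k' + h' * x.2 = t := by
      intro x hx
      rw [hF, Finset.mem_filter, mem_stripPoints] at hx
      exact ⟨hx.1.1.1, hx.2⟩
    have hinj : Set.InjOn Prod.fst (F : Set (ℤ × ℤ)) := by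
      intro x hx y hy hxy
      have h1 := (hmem x hx).2
      have h2 := (hmem y hy).2
      rw [hxy] at h1
      have : h' * x.2 = h' * y.2 := by linarith
      exact Prod.ext hxy (mul_left_cancel₀ hh'0 this)
    have := card_mul_le_of_dvd_sub (F.image Prod.fst) p N h'.natAbs hr ?_ ?_
    · rw [Finset.card_image_of_injOn hinj] at this
      have h3 : F.card ≤ (N + h'.natAbs) / h'.natAbs := (Nat.le_div_iff_mul_le hr).mpr this
      rwa [Nat.add_div_right _ hr] at h3
    · intro a ha
      obtain ⟨x, hx, rfl⟩ := Finset.mem_image.mp ha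
      exact (hmem x hx).1
    · intro a ha b hb
      obtain ⟨x, hx, rfl⟩ := Finset.mem_image.mp ha
      obtain ⟨y, hy, rfl⟩ := Finset.mem_image.mp hb
      rw [Int.natAbs_dvd]
      refine hcop.dvd_of_dvd_mul_right (⟨y.2 - x.2, ?_⟩)
      have h1 := (hmem x hx).2
      have h2 := (hmem y hy).2
      linear_combination h1 - h2
  have hcard := Finset.card_le_mul_card_image_of_maps_to hmaps _ hfib
  have hIcc : (Finset.Icc (-((M / g : ℕ) : ℤ)) ((M / g : ℕ) : ℤ)).card = 2 * (M / g) + 1 := by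
    rw [Int.card_Icc]; omega
  rw [hIcc] at hcard
  have e1 : (2 * (M / g) + 1) * g ≤ 2 * M + g := by
    have := Nat.div_mul_le_self M g
    nlinarith
  have e2 : (N / h'.natAbs + 1) * h'.natAbs ≤ 2 * N := by
    have := Nat.div_mul_le_self N h'.natAbs
    have : h'.natAbs ≤ N := le_trans (by rw [hnat]; exact Nat.le_mul_of_pos_left _ hg0) hN
    nlinarith
  calc (stripPoints p q N M h k).card * h.natAbs
      ≤ ((N / h'.natAbs + 1) * (2 * (M / g) + 1)) * h.natAbs := Nat.mul_le_mul_right _ hcard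
    _ = ((2 * (M / g) + 1) * g) * ((N / h'.natAbs + 1) * h'.natAbs) := by rw [hnat]; ring
    _ ≤ _ := Nat.mul_le_mul e1 e2

theorem sum_gcd_Icc_le (n : ℕ) :
    ∑ k ∈ Finset.Icc (-(n : ℤ)) n, Int.gcd n k ≤ 3 * n * n.divisors.card := by
  rcases Nat.eq_zero_or_pos n with rfl | hn
  · simp
  have h1 : ∀ k ∈ Finset.Icc (-(n : ℤ)) n,
      Int.gcd n k ≤ ∑ e ∈ n.divisors, if (e : ℤ) ∣ k then e else 0 := by
    intro k _
    have hmem : Int.gcd n k ∈ n.divisors := by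
      rw [Nat.mem_divisors]
      exact ⟨by exact_mod_cast (Int.gcd_dvd_left (n : ℤ) k), hn.ne'⟩
    refine le_trans ?_ (Finset.single_le_sum (fun _ _ => Nat.zero_le _) hmem)
    rw [if_pos (Int.gcd_dvd_right ..)]
  refine (Finset.sum_le_sum h1).trans ?_
  rw [Finset.sum_comm, mul_comm, ← smul_eq_mul]
  refine Finset.sum_le_card_nsmul _ _ _ ?_
  intro e he
  rw [← Finset.sum_filter, Finset.sum_const, smul_eq_mul]
  have hen : e ≤ n := Nat.divisor_le he
  have := card_mul_le_of_dvd_sub ((Finset.Icc (-(n : ℤ)) n).filter (fun k => (e : ℤ) ∣ k))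
    (-n) (2 * n) e (Nat.pos_of_mem_divisors he) ?_ ?_
  · omega
  · intro a ha
    rw [Finset.mem_filter, Finset.mem_Icc] at ha
    push_cast
    constructor <;> linarith [ha.1.1, ha.1.2]
  · intro a ha b hb
    rw [Finset.mem_filter] at ha hb
    exact dvd_sub ha.2 hb.2

theorem sum_card_divisors_le (N : ℕ) :
    (∑ n ∈ Finset.Ioc 0 N, (n.divisors.card : ℝ)) ≤ N * (1 + Real.log N) := by
  have h1 : ∑ n ∈ Finset.Ioc 0 N, n.divisors.card = ∑ n ∈ Finset.Ioc 0 N, N / n := by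
    have := ArithmeticFunction.sum_Ioc_sigma0_eq_sum_div N
    simpa [ArithmeticFunction.sigma_zero_apply] using this
  have h2 : (harmonic N : ℝ) = ∑ n ∈ Finset.Ioc 0 N, (n : ℝ)⁻¹ := by
    rw [harmonic_eq_sum_Icc]
    push_cast
    rfl
  calc (∑ n ∈ Finset.Ioc 0 N, (n.divisors.card : ℝ))
      = ∑ n ∈ Finset.Ioc 0 N, ((N / n : ℕ) : ℝ) := by exact_mod_cast h1
    _ ≤ ∑ n ∈ Finset.Ioc 0 N, (N : ℝ) * (n : ℝ)⁻¹ := by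
        refine Finset.sum_le_sum fun n _ => ?_
        rw [← div_eq_mul_inv]
        exact Nat.cast_div_le
    _ = N * (harmonic N : ℝ) := by rw [h2, Finset.mul_sum]
    _ ≤ N * (1 + Real.log N) := by
        gcongr
        exact harmonic_le_one_add_log N

theorem sum_card_stripPoints_le (p q : ℤ) (N M : ℕ) (h : ℤ) (hh : h ≠ 0) (hN : h.natAbs ≤ N) :
    ∑ k ∈ Finset.Icc (-(h.natAbs : ℤ)) h.natAbs, (stripPoints p q N M h k).card ≤
      2 * N * (6 * M + 3 * h.natAbs.divisors.card) := by
  have hpos : 0 < h.natAbs := Int.natAbs_pos.mpr hh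
  refine Nat.le_of_mul_le_mul_right ?_ hpos
  have hgcd : ∀ k : ℤ, Int.gcd h k = Int.gcd (h.natAbs : ℤ) k := by
    intro k; rw [Int.gcd, Int.gcd, Int.natAbs_natCast]
  rw [Finset.sum_mul]
  calc ∑ k ∈ Finset.Icc (-(h.natAbs : ℤ)) h.natAbs, (stripPoints p q N M h k).card * h.natAbs
      ≤ ∑ k ∈ Finset.Icc (-(h.natAbs : ℤ)) h.natAbs,
          (2 * M + Int.gcd (h.natAbs : ℤ) k) * (2 * N) := by
        refine Finset.sum_le_sum fun k _ => ?_
        rw [← hgcd]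
        exact card_stripPoints_mul_le p q N M h k hh hN
    _ = ((2 * h.natAbs + 1) * (2 * M) +
          ∑ k ∈ Finset.Icc (-(h.natAbs : ℤ)) h.natAbs, Int.gcd (h.natAbs : ℤ) k) * (2 * N) := by
        rw [← Finset.sum_mul, Finset.sum_add_distrib, Finset.sum_const, Int.card_Icc, smul_eq_mul]
        congr 4
        omega
    _ ≤ ((3 * h.natAbs) * (2 * M) + 3 * h.natAbs * h.natAbs.divisors.card) * (2 * N) := by
        gcongr
        · omega
        · exact sum_gcd_Icc_le _
    _ = _ := by ring

theorem sum_natAbs_Icc_le (N : ℕ) (G : ℕ → ℕ) :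
    ∑ h ∈ (Finset.Icc (-(N : ℤ)) N).filter (fun h => h ≠ 0), G h.natAbs ≤
      2 * ∑ n ∈ Finset.Ioc 0 N, G n := by
  have hmaps : ∀ h ∈ (Finset.Icc (-(N : ℤ)) N).filter (fun h => h ≠ 0),
      h.natAbs ∈ Finset.Ioc 0 N := by
    intro h hh
    rw [Finset.mem_filter, Finset.mem_Icc] at hh
    rw [Finset.mem_Ioc]
    omega
  rw [← Finset.sum_fiberwise_of_maps_to hmaps, Finset.mul_sum]
  refine Finset.sum_le_sum fun n _ => ?_
  rw [Finset.sum_congr rfl (g := fun _ => G n)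
    (fun h hh => by rw [(Finset.mem_filter.mp hh).2]), Finset.sum_const, smul_eq_mul]
  gcongr
  refine (Finset.card_le_card (t := {(n : ℤ), -(n : ℤ)}) ?_).trans Finset.card_le_two
  intro h hh
  have := (Finset.mem_filter.mp hh).2
  rw [Finset.mem_insert, Finset.mem_singleton]
  omega

theorem sum_sum_card_stripPoints_le (p q : ℤ) (N M : ℕ) :
    ∑ h ∈ (Finset.Icc (-(N : ℤ)) N).filter (fun h => h ≠ 0),
      ∑ k ∈ Finset.Icc (-(h.natAbs : ℤ)) h.natAbs, (stripPoints p q N M h k).card ≤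
      2 * ∑ n ∈ Finset.Ioc 0 N, 2 * N * (6 * M + 3 * n.divisors.card) := by
  refine le_trans (Finset.sum_le_sum fun h hh => ?_)
    (sum_natAbs_Icc_le N (fun n => 2 * N * (6 * M + 3 * n.divisors.card)))
  rw [Finset.mem_filter, Finset.mem_Icc] at hh
  exact sum_card_stripPoints_le p q N M h hh.2 (by omega)

theorem sum_stripPoints_all_le (p q : ℤ) (N M : ℕ) :
    ∑ x ∈ Finset.Icc (-(N : ℤ)) N ×ˢ Finset.Icc (-(N : ℤ)) N,
      (stripPoints p q N M x.1 x.2).card ≤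
      (N + 1) ^ 2 + 4 * ∑ n ∈ Finset.Ioc 0 N, 2 * N * (6 * M + 3 * n.divisors.card) := by
  set B := Finset.Icc (-(N : ℤ)) N with hB
  set c : ℤ → ℤ → ℕ := fun h k => (stripPoints p q N M h k).card with hc
  have hstrip : ∀ p q : ℤ, ∑ h ∈ B, ∑ k ∈ B,
      (if h ≠ 0 ∧ k.natAbs ≤ h.natAbs then (stripPoints p q N M h k).card else 0) ≤
      2 * ∑ n ∈ Finset.Ioc 0 N, 2 * N * (6 * M + 3 * n.divisors.card) := by
    intro p q
    refine le_trans ?_ (sum_sum_card_stripPoints_le p q N M)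
    rw [Finset.sum_filter]
    refine Finset.sum_le_sum fun h _ => ?_
    split_ifs with hh
    · rw [← Finset.sum_filter]
      refine Finset.sum_le_sum_of_subset ?_
      intro k hk
      have := (Finset.mem_filter.mp hk).2.2
      rw [Finset.mem_Icc]
      omega
    · simp [hh]
  have h0 : ∑ h ∈ B, ∑ k ∈ B, (if h = 0 ∧ k = 0 then c h k else 0) ≤ (N + 1) ^ 2 := by
    have h1 : ∀ h ∈ B, ∑ k ∈ B, (if h = 0 ∧ k = 0 then c h k else 0) =
        if h = 0 then (∑ k ∈ B, if k = 0 then c 0 k else 0) else 0 := by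
      intro h _
      by_cases hh : h = 0 <;> simp [hh]
    rw [Finset.sum_congr rfl h1, Finset.sum_ite_eq', Finset.sum_ite_eq']
    have h2 : c 0 0 ≤ (N + 1) ^ 2 := by
      refine (Finset.card_filter_le _ _).trans ?_
      rw [Finset.card_product, Int.card_Icc, Int.card_Icc, sq]
      gcongr <;> omega
    split_ifs <;> simp [h2]
  have hpt : ∀ h k : ℤ, c h k ≤ (if h = 0 ∧ k = 0 then c h k else 0) +
      ((if h ≠ 0 ∧ k.natAbs ≤ h.natAbs then (stripPoints p q N M h k).card else 0) +
      (if k ≠ 0 ∧ h.natAbs ≤ k.natAbs then (stripPoints q p N M k h).card else 0)) := by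
    intro h k
    rw [← card_stripPoints_swap p q N M h k]
    change c h k ≤ _ + ((if _ then c h k else 0) + (if _ then c h k else 0))
    split_ifs <;> omega
  rw [Finset.sum_product]
  refine (Finset.sum_le_sum fun h _ => Finset.sum_le_sum fun k _ => hpt h k).trans ?_
  simp only [Finset.sum_add_distrib]
  have h1 := hstrip p q
  have h2 := hstrip q p
  rw [Finset.sum_comm] at h2
  linarith

/-- The integer points of a square box. -/
def intBox (p q : ℤ) (N : ℕ) : Finset (ℤ × ℤ) :=
  Finset.Icc p (p + N) ×ˢ Finset.Icc q (q + N)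

theorem mem_intBox {p q : ℤ} {N : ℕ} {x : ℤ × ℤ} :
    x ∈ intBox p q N ↔ (p ≤ x.1 ∧ x.1 ≤ p + N) ∧ (q ≤ x.2 ∧ x.2 ≤ q + N) := by
  simp [intBox]

theorem card_near_products_le (p q : ℤ) (N M : ℕ) (hN : 1 ≤ N) :
    ((((intBox p q N ×ˢ intBox p q N).filter
      (fun x => |x.1.1 * x.1.2 - x.2.1 * x.2.2| ≤ (M : ℤ))).card : ℕ) : ℝ) ≤
      48 * N ^ 2 * (M + 1 + Real.log N) := by
  set E := (intBox p q N ×ˢ intBox p q N).filter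
      (fun x => |x.1.1 * x.1.2 - x.2.1 * x.2.2| ≤ (M : ℤ)) with hE
  have hmem : ∀ x ∈ E, (x.1 ∈ intBox p q N ∧ x.2 ∈ intBox p q N) ∧
      |x.1.1 * x.1.2 - x.2.1 * x.2.2| ≤ (M : ℤ) := by
    intro x hx
    rwa [hE, Finset.mem_filter, Finset.mem_product] at hx
  have hmaps : ∀ x ∈ E, (x.2.1 - x.1.1, x.2.2 - x.1.2) ∈
      Finset.Icc (-(N : ℤ)) N ×ˢ Finset.Icc (-(N : ℤ)) N := by
    intro x hx
    obtain ⟨⟨h1, h2⟩, -⟩ := hmem x hx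
    rw [mem_intBox] at h1 h2
    simp only [Finset.mem_product, Finset.mem_Icc]
    omega
  have hcard : E.card ≤ ∑ x ∈ Finset.Icc (-(N : ℤ)) N ×ˢ Finset.Icc (-(N : ℤ)) N,
      (stripPoints p q N M x.1 x.2).card := by
    rw [Finset.card_eq_sum_card_fiberwise hmaps]
    refine Finset.sum_le_sum fun y _ => ?_
    refine Finset.card_le_card_of_injOn (fun x => (x.1.1, x.2.2)) ?_ ?_
    · intro x hx
      obtain ⟨hxE, hxy⟩ := Finset.mem_filter.mp hx
      obtain ⟨⟨h1, h2⟩, h3⟩ := hmem x hxE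
      rw [mem_intBox] at h1 h2
      rw [← hxy, Finset.mem_coe, mem_stripPoints]
      refine ⟨⟨h1.1, h2.2⟩, ?_⟩
      rw [← abs_neg]
      convert h3 using 2
      ring
    · intro x hx z hz hxz
      obtain ⟨-, hx'⟩ := Finset.mem_filter.mp hx
      obtain ⟨-, hz'⟩ := Finset.mem_filter.mp hz
      rw [← hz'] at hx'
      simp only [Prod.mk.injEq] at hx' hxz
      ext <;> omega
  have hfin := hcard.trans (sum_stripPoints_all_le p q N M)
  have hfin' : (E.card : ℝ) ≤ (N + 1) ^ 2 +
      4 * ∑ n ∈ Finset.Ioc 0 N, 2 * (N : ℝ) * (6 * M + 3 * n.divisors.card) := by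
    exact_mod_cast hfin
  have hdiv := sum_card_divisors_le N
  have hsum : ∑ n ∈ Finset.Ioc 0 N, 2 * (N : ℝ) * (6 * M + 3 * n.divisors.card) =
      2 * N * (6 * M * N + 3 * ∑ n ∈ Finset.Ioc 0 N, (n.divisors.card : ℝ)) := by
    rw [← Finset.mul_sum, Finset.sum_add_distrib, ← Finset.mul_sum, ← Finset.mul_sum,
      Finset.sum_const, Nat.card_Ioc, nsmul_eq_mul, Nat.sub_zero]
    ring
  rw [hsum] at hfin'
  have hN' : (1 : ℝ) ≤ N := by exact_mod_cast hN
  have hlog : 0 ≤ Real.log N := Real.log_nonneg hN'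
  calc (E.card : ℝ) ≤ _ := hfin'
    _ ≤ (N + N) ^ 2 + 4 * (2 * N * (6 * M * N + 3 * (N * (1 + Real.log N)))) := by gcongr
    _ ≤ 48 * N ^ 2 * (M + 1 + Real.log N) := by
        have : 0 ≤ (N : ℝ) ^ 2 * Real.log N := by positivity
        nlinarith [sq_nonneg (N : ℝ)]

theorem card_filter_eq_eq_sum {α β γ : Type*} [DecidableEq γ] (X : Finset α) (Y : Finset β)
    (f : α → γ) (g : β → γ) (T : Finset γ) (hf : ∀ a ∈ X, f a ∈ T) :
    ((X ×ˢ Y).filter (fun z => f z.1 = g z.2)).card =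
      ∑ t ∈ T, (X.filter (fun a => f a = t)).card * (Y.filter (fun b => g b = t)).card := by
  rw [Finset.card_eq_sum_card_fiberwise (f := fun z => f z.1) (t := T)]
  · refine Finset.sum_congr rfl fun t _ => ?_
    rw [← Finset.card_product]
    congr 1
    ext z
    simp only [Finset.mem_filter, Finset.mem_product]
    constructor
    · rintro ⟨⟨⟨h1, h2⟩, h3⟩, h4⟩
      exact ⟨⟨h1, h4⟩, h2, h3 ▸ h4⟩
    · rintro ⟨⟨h1, h4⟩, h2, h3⟩
      exact ⟨⟨⟨h1, h2⟩, h4.trans h3.symm⟩, h4⟩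
  · intro z hz
    exact hf _ (Finset.mem_product.mp (Finset.mem_filter.mp hz).1).1

/-- The number of pairs with equal images is controlled by the two collision counts. -/
theorem two_mul_card_filter_eq_le {α β γ : Type*} [DecidableEq γ] (X : Finset α) (Y : Finset β)
    (f : α → γ) (g : β → γ) :
    2 * ((X ×ˢ Y).filter (fun z => f z.1 = g z.2)).card ≤
      ((X ×ˢ X).filter (fun z => f z.1 = f z.2)).card +
      ((Y ×ˢ Y).filter (fun z => g z.1 = g z.2)).card := by
  set T := X.image f ∪ Y.image g with hT
  have hX : ∀ a ∈ X, f a ∈ T := fun a ha =>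
    Finset.mem_union_left _ (Finset.mem_image_of_mem _ ha)
  have hY : ∀ b ∈ Y, g b ∈ T := fun b hb =>
    Finset.mem_union_right _ (Finset.mem_image_of_mem _ hb)
  rw [card_filter_eq_eq_sum X Y f g T hX, card_filter_eq_eq_sum X X f f T hX,
    card_filter_eq_eq_sum Y Y g g T hY, Finset.mul_sum, ← Finset.sum_add_distrib]
  refine Finset.sum_le_sum fun t _ => ?_
  have := two_mul_le_add_sq (X.filter (fun a => f a = t)).card (Y.filter (fun b => g b = t)).card
  nlinarith

theorem abs_sub_le_of_ediv_eq {x y : ℤ} {M : ℕ} (h : x / ((M : ℤ) + 1) = y / ((M : ℤ) + 1)) :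
    |x - y| ≤ M := by
  have hM : (0 : ℤ) < (M : ℤ) + 1 := by positivity
  have h1 := Int.emod_add_mul_ediv x ((M : ℤ) + 1)
  have h2 := Int.emod_add_mul_ediv y ((M : ℤ) + 1)
  have h3 := Int.emod_nonneg x hM.ne'
  have h4 := Int.emod_nonneg y hM.ne'
  have h5 := Int.emod_lt_of_pos x hM
  have h6 := Int.emod_lt_of_pos y hM
  rw [h] at h1
  rw [abs_le]
  constructor <;> linarith

theorem abs_ediv_sub_ediv_le_one {x y : ℤ} {M : ℕ} (h : |x - y| ≤ M) :
    |x / ((M : ℤ) + 1) - y / ((M : ℤ) + 1)| ≤ 1 := by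
  have hM : (0 : ℤ) < (M : ℤ) + 1 := by positivity
  have key : ∀ a b : ℤ, a ≤ b + (M + 1) → a / ((M : ℤ) + 1) ≤ b / ((M : ℤ) + 1) + 1 := by
    intro a b hab
    calc a / ((M : ℤ) + 1) ≤ (b + (M + 1)) / ((M : ℤ) + 1) := Int.ediv_le_ediv hM hab
      _ = b / ((M : ℤ) + 1) + 1 := Int.add_ediv_of_dvd_right (dvd_refl _) |>.trans (by
          rw [Int.ediv_self hM.ne'])
  rw [abs_le] at h ⊢
  have h1 := key x y (by linarith)
  have h2 := key y x (by linarith)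
  constructor <;> linarith

theorem card_bilinear_two_le (p₁ q₁ p₂ q₂ v : ℤ) (N M : ℕ) (hN : 1 ≤ N) :
    ((((intBox p₁ q₁ N ×ˢ intBox p₂ q₂ N).filter
      (fun x => |x.1.1 * x.1.2 + x.2.1 * x.2.2 - v| ≤ (M : ℤ))).card : ℕ) : ℝ) ≤
      144 * N ^ 2 * (M + 1 + Real.log N) := by
  set X := intBox p₁ q₁ N
  set Y := intBox p₂ q₂ N
  set K : ℝ := 48 * N ^ 2 * (M + 1 + Real.log N) with hK
  set f : ℤ × ℤ → ℤ := fun x => x.1 * x.2 / ((M : ℤ) + 1) with hf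
  set g : ℤ → ℤ × ℤ → ℤ := fun s y => (v - y.1 * y.2) / ((M : ℤ) + 1) + s with hg
  have hs : ∀ s : ℤ, ((((X ×ˢ Y).filter (fun z => f z.1 = g s z.2)).card : ℕ) : ℝ) ≤ K := by
    intro s
    have h1 := two_mul_card_filter_eq_le X Y f (g s)
    have h2 : ((((X ×ˢ X).filter (fun z => f z.1 = f z.2)).card : ℕ) : ℝ) ≤ K := by
      refine le_trans ?_ (card_near_products_le p₁ q₁ N M hN)
      exact_mod_cast Finset.card_le_card
        (Finset.monotone_filter_right _ fun z _ hz => abs_sub_le_of_ediv_eq hz)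
    have h3 : ((((Y ×ˢ Y).filter (fun z => g s z.1 = g s z.2)).card : ℕ) : ℝ) ≤ K := by
      refine le_trans ?_ (card_near_products_le p₂ q₂ N M hN)
      have : ∀ z : (ℤ × ℤ) × (ℤ × ℤ), g s z.1 = g s z.2 →
          |z.1.1 * z.1.2 - z.2.1 * z.2.2| ≤ (M : ℤ) := by
        intro z hz
        have := abs_sub_le_of_ediv_eq (add_right_cancel hz)
        rw [← abs_neg]
        convert this using 2
        ring
      exact_mod_cast Finset.card_le_card (Finset.monotone_filter_right _ fun z _ hz => this z hz)
    have h1' : (2 : ℝ) * (((X ×ˢ Y).filter (fun z => f z.1 = g s z.2)).card : ℕ) ≤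
        (((X ×ˢ X).filter (fun z => f z.1 = f z.2)).card : ℕ) +
        (((Y ×ˢ Y).filter (fun z => g s z.1 = g s z.2)).card : ℕ) := by exact_mod_cast h1
    linarith
  have hsub : (X ×ˢ Y).filter (fun x => |x.1.1 * x.1.2 + x.2.1 * x.2.2 - v| ≤ (M : ℤ)) ⊆
      (Finset.Icc (-1 : ℤ) 1).biUnion
        (fun s => (X ×ˢ Y).filter (fun z => f z.1 = g s z.2)) := by
    intro z hz
    obtain ⟨hz1, hz2⟩ := Finset.mem_filter.mp hz
    have h1 : |z.1.1 * z.1.2 - (v - z.2.1 * z.2.2)| ≤ (M : ℤ) := by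
      convert hz2 using 2; ring
    have h2 := abs_le.mp (abs_ediv_sub_ediv_le_one h1)
    rw [Finset.mem_biUnion]
    refine ⟨_, Finset.mem_Icc.mpr h2, Finset.mem_filter.mpr ⟨hz1, ?_⟩⟩
    simp only [hf, hg]
    ring
  have hcard := (Finset.card_le_card hsub).trans Finset.card_biUnion_le
  have hcard' : ((((X ×ˢ Y).filter
      (fun x => |x.1.1 * x.1.2 + x.2.1 * x.2.2 - v| ≤ (M : ℤ))).card : ℕ) : ℝ) ≤
      ∑ s ∈ Finset.Icc (-1 : ℤ) 1, (((X ×ˢ Y).filter (fun z => f z.1 = g s z.2)).card : ℝ) := by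
    exact_mod_cast hcard
  refine hcard'.trans ((Finset.sum_le_card_nsmul _ _ K fun s _ => hs s).trans ?_)
  rw [show (Finset.Icc (-1 : ℤ) 1).card = 3 from rfl, nsmul_eq_mul, hK]
  push_cast
  apply le_of_eq
  ring

theorem card_bilinear_le (n : ℕ) (p q : Fin (n + 2) → ℤ) (v : ℤ) (N M : ℕ) (hN : 1 ≤ N) :
    ((((Finset.Icc p (fun i => p i + N) ×ˢ Finset.Icc q (fun i => q i + N)).filter
      (fun x => |∑ i, x.1 i * x.2 i - v| ≤ (M : ℤ))).card : ℕ) : ℝ) ≤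
      144 * N ^ 2 * (M + 1 + Real.log N) * ((N : ℝ) + 1) ^ (2 * n) := by
  set S := (Finset.Icc p (fun i => p i + N) ×ˢ Finset.Icc q (fun i => q i + N)).filter
      (fun x => |∑ i, x.1 i * x.2 i - v| ≤ (M : ℤ)) with hS
  have hlog : 0 ≤ Real.log N := Real.log_natCast_nonneg N
  set K : ℝ := 144 * N ^ 2 * (M + 1 + Real.log N) with hK
  have hK0 : 0 ≤ K := by positivity
  set t : (Fin n → ℤ) → Finset (Fin n → ℤ) := fun r => Finset.Icc r (fun i => r i + N) with ht
  set P : Finset ((Fin n → ℤ) × (Fin n → ℤ)) :=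
    t (fun i => p i.succ.succ) ×ˢ t (fun i => q i.succ.succ) with hP
  set φ : (Fin (n + 2) → ℤ) × (Fin (n + 2) → ℤ) → (Fin n → ℤ) × (Fin n → ℤ) :=
    fun x => (fun i => x.1 i.succ.succ, fun i => x.2 i.succ.succ) with hφ
  have hmem : ∀ x ∈ S, (∀ i, p i ≤ x.1 i ∧ x.1 i ≤ p i + N) ∧
      (∀ i, q i ≤ x.2 i ∧ x.2 i ≤ q i + N) ∧ |∑ i, x.1 i * x.2 i - v| ≤ (M : ℤ) := by
    intro x hx
    rw [hS, Finset.mem_filter, Finset.mem_product, Finset.mem_Icc, Finset.mem_Icc] at hx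
    obtain ⟨⟨⟨h1, h2⟩, h3, h4⟩, h5⟩ := hx
    exact ⟨fun i => ⟨h1 i, h2 i⟩, fun i => ⟨h3 i, h4 i⟩, h5⟩
  have hmaps : ∀ x ∈ S, φ x ∈ P := by
    intro x hx
    obtain ⟨h1, h2, -⟩ := hmem x hx
    simp only [hP, ht, hφ, Finset.mem_product, Finset.mem_Icc]
    exact ⟨⟨fun i => (h1 _).1, fun i => (h1 _).2⟩, fun i => (h2 _).1, fun i => (h2 _).2⟩
  have hfib : ∀ y ∈ P, (S.filter (fun x => φ x = y)).card ≤ ⌊K⌋₊ := by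
    intro y _
    refine Nat.le_floor (le_trans ?_
      (card_bilinear_two_le (p 0) (q 0) (p 1) (q 1) (v - ∑ i, y.1 i * y.2 i) N M hN))
    rw [Nat.cast_le]
    refine Finset.card_le_card_of_injOn (fun x => ((x.1 0, x.2 0), (x.1 1, x.2 1))) ?_ ?_
    · intro x hx
      obtain ⟨hxS, hxy⟩ := Finset.mem_filter.mp hx
      obtain ⟨h1, h2, h3⟩ := hmem x hxS
      rw [Finset.mem_coe, Finset.mem_filter, Finset.mem_product, mem_intBox, mem_intBox]
      refine ⟨⟨⟨h1 0, h2 0⟩, h1 1, h2 1⟩, ?_⟩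
      rw [← hxy]
      rw [Fin.sum_univ_succ, Fin.sum_univ_succ] at h3
      convert h3 using 2
      simp only [hφ, Fin.succ_zero_eq_one]
      ring
    · intro x hx z hz hxz
      have hx' := (Finset.mem_filter.mp hx).2
      rw [← (Finset.mem_filter.mp hz).2] at hx'
      simp only [hφ, Prod.mk.injEq] at hx' hxz
      obtain ⟨⟨h1, h2⟩, h3, h4⟩ := hxz
      refine Prod.ext (funext fun i => ?_) (funext fun i => ?_)
      · refine Fin.cases h1 (fun j => ?_) i
        exact Fin.cases h3 (fun l => congrFun hx'.1 l) j
      · refine Fin.cases h2 (fun j => ?_) i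
        exact Fin.cases h4 (fun l => congrFun hx'.2 l) j
  have hcard := Finset.card_le_mul_card_image_of_maps_to hmaps _ hfib
  have htcard : ∀ r, (t r).card = (N + 1) ^ n := by
    intro r
    simp only [ht, Pi.card_Icc, Int.card_Icc]
    rw [Finset.prod_congr rfl (g := fun _ => N + 1) (fun i _ => by omega)]
    simp
  rw [hP, Finset.card_product, htcard, htcard] at hcard
  calc (S.card : ℝ) ≤ ((⌊K⌋₊ * ((N + 1) ^ n * (N + 1) ^ n) : ℕ) : ℝ) := by exact_mod_cast hcard
    _ = (⌊K⌋₊ : ℝ) * ((N : ℝ) + 1) ^ (2 * n) := by push_cast; ring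
    _ ≤ K * ((N : ℝ) + 1) ^ (2 * n) := by
        gcongr
        exact Nat.floor_le hK0

theorem mem_Icc_of_near {L : ℝ} (hL : 0 < L) {m : ℤ} {x y : ℝ} (hx : x = (m : ℝ) / L)
    (hxy : |x - y| ≤ 1) :
    ⌈L * y - L⌉ ≤ m ∧ m ≤ ⌈L * y - L⌉ + (⌊2 * L⌋₊ : ℤ) := by
  have hm : (m : ℝ) = L * x := by rw [hx]; field_simp
  obtain ⟨h1, h2⟩ := abs_le.mp hxy
  constructor
  · rw [Int.ceil_le, hm]
    nlinarith
  · have h3 : m - ⌈L * y - L⌉ ≤ ⌊2 * L⌋ := by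
      rw [Int.le_floor]
      push_cast
      have := Int.le_ceil (L * y - L)
      rw [hm]
      nlinarith
    rw [Int.natCast_floor_eq_floor (by positivity)]
    linarith

theorem ncard_near_inner_le (n : ℕ) (γ : ℝ) (hγ : γ < 1) :
    ∃ C : ℝ, 2 ≤ C ∧ ∀ L W : ℝ, 2 ≤ L → L ^ (-(2 * γ)) ≤ W →
    ∀ (x₀ y₀ : EuclideanSpace ℝ (Fin (n + 2))) (β : ℝ),
      {z : EuclideanSpace ℝ (Fin (n + 2)) × EuclideanSpace ℝ (Fin (n + 2)) |
        z.1 ∈ ZLat (n + 2) L ∧ z.2 ∈ ZLat (n + 2) L ∧ ‖z.1 - x₀‖ ≤ 1 ∧ ‖z.2 - y₀‖ ≤ 1 ∧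
          |⟪z.1, z.2⟫ - β| ≤ W}.Finite ∧
      (Set.ncard {z : EuclideanSpace ℝ (Fin (n + 2)) × EuclideanSpace ℝ (Fin (n + 2)) |
        z.1 ∈ ZLat (n + 2) L ∧ z.2 ∈ ZLat (n + 2) L ∧ ‖z.1 - x₀‖ ≤ 1 ∧ ‖z.2 - y₀‖ ≤ 1 ∧
          |⟪z.1, z.2⟫ - β| ≤ W} : ℝ) ≤ C * W * L ^ (2 * (n + 2)) := by
  set s : ℝ := 2 - 2 * γ with hs
  have hs0 : 0 < s := by linarith
  have hs' : 0 < 4 / s := by positivity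
  have h9 : (1 : ℝ) ≤ 9 ^ n := one_le_pow₀ (by norm_num)
  refine ⟨576 * (4 + 4 / s * 2 ^ s) * 9 ^ n, ?_, ?_⟩
  · have : 0 < 4 / s * (2 : ℝ) ^ s := by positivity
    nlinarith
  intro L W hL hW x₀ y₀ β
  set P := {z : EuclideanSpace ℝ (Fin (n + 2)) × EuclideanSpace ℝ (Fin (n + 2)) |
        z.1 ∈ ZLat (n + 2) L ∧ z.2 ∈ ZLat (n + 2) L ∧ ‖z.1 - x₀‖ ≤ 1 ∧ ‖z.2 - y₀‖ ≤ 1 ∧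
          |⟪z.1, z.2⟫ - β| ≤ W} with hP
  have hL0 : 0 < L := by linarith
  have hW0 : 0 < W := lt_of_lt_of_le (by positivity) hW
  set N := ⌊2 * L⌋₊ with hN
  set M := ⌈L ^ 2 * W⌉₊ + 1 with hM
  set p : Fin (n + 2) → ℤ := fun i => ⌈L * x₀ i - L⌉ with hp
  set q : Fin (n + 2) → ℤ := fun i => ⌈L * y₀ i - L⌉ with hq
  set v : ℤ := ⌊L ^ 2 * β⌋ with hv
  set S := (Finset.Icc p (fun i => p i + N) ×ˢ Finset.Icc q (fun i => q i + N)).filter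
      (fun x => |∑ i, x.1 i * x.2 i - v| ≤ (M : ℤ)) with hS
  let ψ : (Fin (n + 2) → ℤ) × (Fin (n + 2) → ℤ) →
      EuclideanSpace ℝ (Fin (n + 2)) × EuclideanSpace ℝ (Fin (n + 2)) :=
    fun z => (WithLp.toLp 2 (fun i => (z.1 i : ℝ) / L), WithLp.toLp 2 (fun i => (z.2 i : ℝ) / L))
  have hsub : P ⊆ ((S.image ψ : Finset _) : Set _) := by
    rintro ⟨x, y⟩ ⟨hx, hy, hxn, hyn, hin⟩
    choose a ha using hx
    choose b hb using hy
    simp only at ha hb hxn hyn hin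
    rw [Finset.mem_coe, Finset.mem_image]
    refine ⟨(a, b), ?_, ?_⟩
    · have hxi : ∀ i, |x i - x₀ i| ≤ 1 := fun i => (PiLp.norm_apply_le (x - x₀) i).trans hxn
      have hyi : ∀ i, |y i - y₀ i| ≤ 1 := fun i => (PiLp.norm_apply_le (y - y₀) i).trans hyn
      rw [hS, Finset.mem_filter, Finset.mem_product, Finset.mem_Icc, Finset.mem_Icc]
      refine ⟨⟨⟨fun i => (mem_Icc_of_near hL0 (ha i) (hxi i)).1,
        fun i => (mem_Icc_of_near hL0 (ha i) (hxi i)).2⟩,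
        fun i => (mem_Icc_of_near hL0 (hb i) (hyi i)).1,
        fun i => (mem_Icc_of_near hL0 (hb i) (hyi i)).2⟩, ?_⟩
      have hinner : ((∑ i, a i * b i : ℤ) : ℝ) = L ^ 2 * ⟪x, y⟫ := by
        rw [PiLp.inner_apply, Finset.mul_sum]
        push_cast
        refine Finset.sum_congr rfl fun i _ => ?_
        rw [ha i, hb i]
        simp only [RCLike.inner_apply, conj_trivial]
        field_simp
      have h1 : |((∑ i, a i * b i - v : ℤ) : ℝ)| ≤ ((M : ℤ) : ℝ) := by
        rw [Int.cast_sub, hinner]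
        have h2 : |L ^ 2 * ⟪x, y⟫ - L ^ 2 * β| ≤ L ^ 2 * W := by
          rw [← mul_sub, abs_mul, abs_of_pos (by positivity : 0 < L ^ 2)]
          gcongr
        have h3 := Int.floor_le (L ^ 2 * β)
        have h4 := Int.lt_floor_add_one (L ^ 2 * β)
        have h5 := Nat.le_ceil (L ^ 2 * W)
        rw [hM]
        push_cast
        rw [abs_le] at h2 ⊢
        constructor <;> linarith [h2.1, h2.2]
      exact_mod_cast h1
    · simp only [ψ]
      congr 1
      · ext i; simp [ha]
      · ext i; simp [hb]
  refine ⟨(Finset.finite_toSet _).subset hsub, ?_⟩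
  have hcard : P.ncard ≤ S.card := by
    refine (Set.ncard_le_ncard hsub (Finset.finite_toSet _)).trans ?_
    rw [Set.ncard_coe_finset]
    exact Finset.card_image_le
  have hN1 : 1 ≤ N := Nat.le_floor (by push_cast; linarith)
  have hN1' : (1 : ℝ) ≤ N := by exact_mod_cast hN1
  have hN2 : (N : ℝ) ≤ 2 * L := Nat.floor_le (by positivity)
  have hLs : L ^ s ≤ L ^ 2 * W := by
    calc L ^ s = L ^ (2 : ℝ) * L ^ (-(2 * γ)) := by
          rw [← Real.rpow_add hL0, hs]; congr 1
      _ = L ^ 2 * L ^ (-(2 * γ)) := by norm_cast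
      _ ≤ L ^ 2 * W := by gcongr
  have hone : 1 ≤ L ^ s := Real.one_le_rpow (by linarith) hs0.le
  have hlog : Real.log N ≤ 4 / s * 2 ^ s * (L ^ 2 * W) := by
    calc Real.log N ≤ Real.log (2 * L) := Real.log_le_log (by linarith) hN2
      _ ≤ (2 * L) ^ s / s := Real.log_le_rpow_div (by positivity) hs0
      _ = 1 / s * 2 ^ s * L ^ s := by rw [Real.mul_rpow (by norm_num) hL0.le]; ring
      _ ≤ 4 / s * 2 ^ s * (L ^ 2 * W) := by gcongr; norm_num
  have hM2 : (M : ℝ) ≤ L ^ 2 * W + 2 := by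
    rw [hM]
    push_cast
    have := Nat.ceil_lt_add_one (by positivity : 0 ≤ L ^ 2 * W)
    linarith
  have hlog0 : 0 ≤ Real.log N := Real.log_natCast_nonneg N
  calc (P.ncard : ℝ) ≤ S.card := by exact_mod_cast hcard
    _ ≤ 144 * N ^ 2 * (M + 1 + Real.log N) * ((N : ℝ) + 1) ^ (2 * n) :=
        card_bilinear_le n p q v N M hN1
    _ ≤ 144 * (2 * L) ^ 2 * ((4 + 4 / s * 2 ^ s) * (L ^ 2 * W)) * (3 * L) ^ (2 * n) := by
        gcongr
        · linarith
        · linarith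
    _ = 576 * (4 + 4 / s * 2 ^ s) * 9 ^ n * W * L ^ (2 * (n + 2)) := by
        rw [mul_pow 3 L, pow_mul (3 : ℝ) 2 n]
        norm_num
        ring

theorem ZLat_sub {d : ℕ} {L : ℝ} {x y : EuclideanSpace ℝ (Fin d)} (hx : x ∈ ZLat d L)
    (hy : y ∈ ZLat d L) : x - y ∈ ZLat d L := by
  intro i
  obtain ⟨a, ha⟩ := hx i
  obtain ⟨b, hb⟩ := hy i
  refine ⟨a - b, ?_⟩
  rw [PiLp.sub_apply, ha, hb]
  push_cast
  ring

theorem ZLat_neg {d : ℕ} {L : ℝ} {x : EuclideanSpace ℝ (Fin d)} (hx : x ∈ ZLat d L) :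
    -x ∈ ZLat d L := by
  intro i
  obtain ⟨a, ha⟩ := hx i
  refine ⟨-a, ?_⟩
  rw [PiLp.neg_apply, ha]
  push_cast
  ring

/-- The resonance function of `u + v - w` factorizes as an inner product. -/
theorem norm_sq_add_sub_eq {E : Type*} [NormedAddCommGroup E] [InnerProductSpace ℝ E]
    {u v w k : E} (h : u + v - w = k) :
    ‖u‖ ^ 2 + ‖v‖ ^ 2 - ‖w‖ ^ 2 = ‖k‖ ^ 2 - 2 * ⟪u - k, v - k⟫ := by
  have hw : w = u + v - k := by rw [← h]; abel
  rw [hw]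
  simp only [← real_inner_self_eq_norm_sq, inner_sub_left, inner_sub_right, inner_add_left,
    inner_add_right]
  rw [real_inner_comm u v, real_inner_comm k u, real_inner_comm k v]
  ring

/-- Lattice triples with `u + v - w = k` that are nearly resonant. -/
def resonantTriples (d : ℕ) (L W : ℝ) (u₀ v₀ k : EuclideanSpace ℝ (Fin d)) (β : ℝ) :
    Set (EuclideanSpace ℝ (Fin d) × EuclideanSpace ℝ (Fin d) × EuclideanSpace ℝ (Fin d)) :=
  {q | q.1 ∈ ZLat d L ∧ q.2.1 ∈ ZLat d L ∧ ‖q.1 - u₀‖ ≤ 1 ∧ ‖q.2.1 - v₀‖ ≤ 1 ∧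
    q.1 + q.2.1 - q.2.2 = k ∧ |‖q.1‖ ^ 2 + ‖q.2.1‖ ^ 2 - ‖q.2.2‖ ^ 2 - β| ≤ W}

theorem ncard_resonantTriples_le (n : ℕ) (γ : ℝ) (hγ : γ < 1) :
    ∃ C : ℝ, 2 ≤ C ∧ ∀ L W : ℝ, 2 ≤ L → L ^ (-(2 * γ)) ≤ W →
    ∀ (u₀ v₀ k : EuclideanSpace ℝ (Fin (n + 2))) (β : ℝ), k ∈ ZLat (n + 2) L →
      (resonantTriples (n + 2) L W u₀ v₀ k β).Finite ∧
      ((resonantTriples (n + 2) L W u₀ v₀ k β).ncard : ℝ) ≤ C * W * L ^ (2 * (n + 2)) := by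
  obtain ⟨C, hC, h⟩ := ncard_near_inner_le n γ hγ
  refine ⟨C, hC, fun L W hL hW u₀ v₀ k β hk => ?_⟩
  obtain ⟨hfin, hcard⟩ := h L W hL hW (u₀ - k) (v₀ - k) ((‖k‖ ^ 2 - β) / 2)
  set P := {z : EuclideanSpace ℝ (Fin (n + 2)) × EuclideanSpace ℝ (Fin (n + 2)) |
        z.1 ∈ ZLat (n + 2) L ∧ z.2 ∈ ZLat (n + 2) L ∧ ‖z.1 - (u₀ - k)‖ ≤ 1 ∧
          ‖z.2 - (v₀ - k)‖ ≤ 1 ∧ |⟪z.1, z.2⟫ - (‖k‖ ^ 2 - β) / 2| ≤ W}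
  set φ : EuclideanSpace ℝ (Fin (n + 2)) × EuclideanSpace ℝ (Fin (n + 2)) ×
      EuclideanSpace ℝ (Fin (n + 2)) → EuclideanSpace ℝ (Fin (n + 2)) ×
      EuclideanSpace ℝ (Fin (n + 2)) := fun q => (q.1 - k, q.2.1 - k) with hφ
  have hmaps : ∀ q ∈ resonantTriples (n + 2) L W u₀ v₀ k β, φ q ∈ P := by
    rintro ⟨u, v, w⟩ ⟨h1, h2, h3, h4, h5, h6⟩
    refine ⟨ZLat_sub h1 hk, ZLat_sub h2 hk, ?_, ?_, ?_⟩
    · simpa [hφ] using h3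
    · simpa [hφ] using h4
    · simp only at h5 h6
      rw [norm_sq_add_sub_eq h5] at h6
      simp only [hφ]
      rw [abs_le] at h6 ⊢
      constructor <;> linarith [h6.1, h6.2]
  have hinj : Set.InjOn φ (resonantTriples (n + 2) L W u₀ v₀ k β) := by
    rintro ⟨u, v, w⟩ ⟨-, -, -, -, h5, -⟩ ⟨u', v', w'⟩ ⟨-, -, -, -, h5', -⟩ heq
    simp only [hφ, Prod.mk.injEq, sub_left_inj] at heq h5 h5'
    obtain ⟨rfl, rfl⟩ := heq
    rw [← h5', sub_right_inj] at h5
    rw [h5]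
  refine ⟨Set.Finite.of_injOn hmaps hinj hfin, le_trans ?_ hcard⟩
  exact_mod_cast Set.ncard_le_ncard_of_injOn φ hmaps hinj hfin

theorem statement7 (d : ℕ) (hd : 3 ≤ d) (γ : ℝ) (hγ : 0 < γ) (hγ' : γ < 1) :
    ∃ η₀ : ℝ, 0 < η₀ ∧ ∀ η : ℝ, 0 < η → η ≤ η₀ →
    ∃ C : ℝ, 2 ≤ C ∧
    ∀ L δ : ℝ, C ≤ L → 0 < δ → δ < 1 → δ⁻¹ ≤ L ^ (η ^ 2) →
    ∀ ε₁ ε₂ ε₃ : ℝ, (ε₁ = 1 ∨ ε₁ = -1) → (ε₂ = 1 ∨ ε₂ = -1) → (ε₃ = 1 ∨ ε₃ = -1) →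
      ¬(ε₁ = ε₂ ∧ ε₂ = ε₃) →
    ∀ (k10 k20 k30 k : EuclideanSpace ℝ (Fin d)), k ∈ ZLat d L → ∀ β : ℝ,
      (Set.ncard {q : EuclideanSpace ℝ (Fin d) × EuclideanSpace ℝ (Fin d) ×
            EuclideanSpace ℝ (Fin d) |
          q.1 ∈ ZLat d L ∧ q.2.1 ∈ ZLat d L ∧ q.2.2 ∈ ZLat d L ∧
          ‖q.1 - k10‖ ≤ 1 ∧ ‖q.2.1 - k20‖ ≤ 1 ∧ ‖q.2.2 - k30‖ ≤ 1 ∧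
          ε₁ • q.1 + ε₂ • q.2.1 + ε₃ • q.2.2 = k ∧
          |ε₁ * ‖q.1‖ ^ 2 + ε₂ * ‖q.2.1‖ ^ 2 + ε₃ * ‖q.2.2‖ ^ 2 - β| ≤
            δ⁻¹ * L ^ (-(2 * γ))} : ℝ) ≤
        C * δ⁻¹ * L ^ (2 * ((d : ℝ) - γ)) := by
  obtain ⟨n, rfl⟩ : ∃ n, d = n + 2 := ⟨d - 2, by omega⟩
  obtain ⟨C, hC, hmain⟩ := ncard_resonantTriples_le n γ hγ'
  refine ⟨1, one_pos, fun η _ _ => ⟨C, hC, ?_⟩⟩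
  intro L δ hL hδ hδ' _ ε₁ ε₂ ε₃ h₁ h₂ h₃ hne k10 k20 k30 k hk β
  have hL2 : 2 ≤ L := hC.trans hL
  have hL0 : 0 < L := by linarith
  set W := δ⁻¹ * L ^ (-(2 * γ)) with hW
  have hWL : L ^ (-(2 * γ)) ≤ W :=
    le_mul_of_one_le_left (by positivity) ((one_le_inv₀ hδ).mpr hδ'.le)
  have hbound : C * W * L ^ (2 * (n + 2)) =
      C * δ⁻¹ * L ^ (2 * (((n + 2 : ℕ) : ℝ) - γ)) := by
    have : L ^ (2 * (((n + 2 : ℕ) : ℝ) - γ)) = L ^ (-(2 * γ)) * L ^ (2 * (n + 2)) := by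
      rw [← Real.rpow_natCast, ← Real.rpow_add hL0]
      congr 1
      push_cast
      ring
    rw [this, hW]
    ring
  rw [← hbound]
  have hT := hmain L W hL2 hWL
  rcases h₁ with rfl | rfl <;> rcases h₂ with rfl | rfl <;> rcases h₃ with rfl | rfl
  · exact absurd ⟨rfl, rfl⟩ hne
  · obtain ⟨hfin, hcard⟩ := hT k10 k20 k β hk
    refine le_trans (Nat.cast_le.mpr (Set.ncard_le_ncard_of_injOn
      (fun q => (q.1, q.2.1, q.2.2)) ?_ ?_ hfin)) hcard
    · rintro ⟨u, v, w⟩ ⟨h1, h2, h3, h4, h5, h6, h7, h8⟩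
      refine ⟨h1, h2, h4, h5, ?_, ?_⟩
      · rw [← h7]; module
      · convert h8 using 2; ring
    · rintro ⟨u, v, w⟩ _ ⟨u', v', w'⟩ _ heq
      simp only [Prod.mk.injEq] at heq ⊢
      tauto
  · obtain ⟨hfin, hcard⟩ := hT k10 k30 k β hk
    refine le_trans (Nat.cast_le.mpr (Set.ncard_le_ncard_of_injOn
      (fun q => (q.1, q.2.2, q.2.1)) ?_ ?_ hfin)) hcard
    · rintro ⟨u, v, w⟩ ⟨h1, h2, h3, h4, h5, h6, h7, h8⟩
      refine ⟨h1, h3, h4, h6, ?_, ?_⟩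
      · rw [← h7]; module
      · convert h8 using 2; ring
    · rintro ⟨u, v, w⟩ _ ⟨u', v', w'⟩ _ heq
      simp only [Prod.mk.injEq] at heq ⊢
      tauto
  · obtain ⟨hfin, hcard⟩ := hT k20 k30 (-k) (-β) (ZLat_neg hk)
    refine le_trans (Nat.cast_le.mpr (Set.ncard_le_ncard_of_injOn
      (fun q => (q.2.1, q.2.2, q.1)) ?_ ?_ hfin)) hcard
    · rintro ⟨u, v, w⟩ ⟨h1, h2, h3, h4, h5, h6, h7, h8⟩
      refine ⟨h2, h3, h5, h6, ?_, ?_⟩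
      · rw [← h7]; module
      · rw [← abs_neg]; convert h8 using 2; ring
    · rintro ⟨u, v, w⟩ _ ⟨u', v', w'⟩ _ heq
      simp only [Prod.mk.injEq] at heq ⊢
      tauto
  · obtain ⟨hfin, hcard⟩ := hT k20 k30 k β hk
    refine le_trans (Nat.cast_le.mpr (Set.ncard_le_ncard_of_injOn
      (fun q => (q.2.1, q.2.2, q.1)) ?_ ?_ hfin)) hcard
    · rintro ⟨u, v, w⟩ ⟨h1, h2, h3, h4, h5, h6, h7, h8⟩
      refine ⟨h2, h3, h5, h6, ?_, ?_⟩
      · rw [← h7]; module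
      · convert h8 using 2; ring
    · rintro ⟨u, v, w⟩ _ ⟨u', v', w'⟩ _ heq
      simp only [Prod.mk.injEq] at heq ⊢
      tauto
  · obtain ⟨hfin, hcard⟩ := hT k10 k30 (-k) (-β) (ZLat_neg hk)
    refine le_trans (Nat.cast_le.mpr (Set.ncard_le_ncard_of_injOn
      (fun q => (q.1, q.2.2, q.2.1)) ?_ ?_ hfin)) hcard
    · rintro ⟨u, v, w⟩ ⟨h1, h2, h3, h4, h5, h6, h7, h8⟩
      refine ⟨h1, h3, h4, h6, ?_, ?_⟩
      · rw [← h7]; module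
      · rw [← abs_neg]; convert h8 using 2; ring
    · rintro ⟨u, v, w⟩ _ ⟨u', v', w'⟩ _ heq
      simp only [Prod.mk.injEq] at heq ⊢
      tauto
  · obtain ⟨hfin, hcard⟩ := hT k10 k20 (-k) (-β) (ZLat_neg hk)
    refine le_trans (Nat.cast_le.mpr (Set.ncard_le_ncard_of_injOn
      (fun q => (q.1, q.2.1, q.2.2)) ?_ ?_ hfin)) hcard
    · rintro ⟨u, v, w⟩ ⟨h1, h2, h3, h4, h5, h6, h7, h8⟩
      refine ⟨h1, h2, h4, h5, ?_, ?_⟩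
      · rw [← h7]; module
      · rw [← abs_neg]; convert h8 using 2; ring
    · rintro ⟨u, v, w⟩ _ ⟨u', v', w'⟩ _ heq
      simp only [Prod.mk.injEq] at heq ⊢
      tauto
  · exact absurd ⟨rfl, rfl⟩ hne
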